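/- For every integer k ≥ 2 and all sufficiently large real c (e.g. c ≥ 2 log(2k) suffices), the equation x = (1 - e^{-cx})^{k-1} has a solution x in the interval [1 - 2k e^{-c}, 1]. -/

import Mathlib

open Real Set

/-- For every integer `k ≥ 2` and all `c ≥ 2 log (2k)`, the equation
`x = (1 - e^{-cx})^{k-1}` has a solution `x ∈ [1 - 2k e^{-c}, 1]`. -/
theorem fixed_point_near_one (k : ℕ) (hk : 2 ≤ k) (c : ℝ)
    (hc : 2 * Real.log (2 * k) ≤ c) :
    ∃ x ∈ Icc (1 - 2 * (k:ℝ) * Real.exp (-c)) 1,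
      x = (1 - Real.exp (-c * x)) ^ (k - 1) := by
  have hkR : (2:ℝ) ≤ k := by exact_mod_cast hk
  have hk0 : (0:ℝ) < k := by linarith
  obtain ⟨L, hL⟩ : ∃ L, L = Real.log (2 * k) := ⟨_, rfl⟩
  rw [← hL] at hc
  have hexpL : Real.exp L = 2 * k := by rw [hL, Real.exp_log (by positivity)]
  have hL1 : 1 ≤ L := by
    rw [hL, Real.le_log_iff_exp_le (by positivity)]
    linarith [Real.exp_one_lt_d9]
  have hE0 : 0 < Real.exp (-c) := Real.exp_pos _
  -- L ≤ k log 2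
  have hpow : 2 * k ≤ 2 ^ k := by
    clear * - hk
    induction k, hk using Nat.le_induction with
    | base => norm_num
    | succ n hn ih => rw [pow_succ]; omega
  have hLk : L ≤ k * Real.log 2 := by
    rw [hL, ← Real.log_pow]
    apply Real.log_le_log (by positivity)
    exact_mod_cast hpow
  -- c e^{-c} ≤ 2L / (4k²)
  have hexp2 : Real.exp (2 * L) = 4 * k ^ 2 := by
    rw [two_mul, Real.exp_add, hexpL]; ring
  have hexpc : 4 * (k:ℝ) ^ 2 * (1 + (c - 2 * L)) ≤ Real.exp c := by
    have h : Real.exp c = Real.exp (2 * L) * Real.exp (c - 2 * L) := by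
      rw [← Real.exp_add]; ring_nf
    rw [h, hexp2]
    gcongr
    linarith [Real.add_one_le_exp (c - 2 * L)]
  have hEE : Real.exp c * Real.exp (-c) = 1 := by rw [← Real.exp_add]; simp
  have hcy : c * (2 * k * Real.exp (-c)) ≤ Real.log 2 := by
    have h1 : c ≤ 2 * L * (1 + (c - 2 * L)) := by nlinarith
    have h2 : c * (2 * k ) ≤ Real.log 2 * Real.exp c := by
      have hl2 : 0 < Real.log 2 := Real.log_pos (by norm_num)
      have hd : 0 ≤ 1 + (c - 2 * L) := by linarith
      calc c * (2 * k) ≤ (2 * L * (1 + (c - 2 * L))) * (2 * k) := by gcongr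
        _ ≤ (2 * (k * Real.log 2) * (1 + (c - 2 * L))) * (2 * k) := by gcongr
        _ = Real.log 2 * (4 * (k:ℝ) ^ 2 * (1 + (c - 2 * L))) := by ring
        _ ≤ _ := by gcongr
    calc c * (2 * k * Real.exp (-c)) = c * (2 * k) * Real.exp (-c) := by ring
      _ ≤ Real.log 2 * Real.exp c * Real.exp (-c) := by gcongr
      _ = Real.log 2 := by rw [mul_assoc, hEE, mul_one]
  have hy0 : 0 < 2 * k * Real.exp (-c) := by positivity
  have hc2 : 2 ≤ c := by linarith
  have hy1 : 2 * k * Real.exp (-c) ≤ 1 := by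
    have := Real.log_two_lt_d9
    nlinarith
  have hlow : 1 - 2 * (k:ℝ) * Real.exp (-c) ≤
      (1 - Real.exp (-c * (1 - 2 * (k:ℝ) * Real.exp (-c)))) ^ (k - 1) := by
    have h1 : Real.exp (-c * (1 - 2 * (k:ℝ) * Real.exp (-c))) ≤ 2 * Real.exp (-c) := by
      have : -c * (1 - 2 * (k:ℝ) * Real.exp (-c)) = c * (2 * k * Real.exp (-c)) + -c := by ring
      rw [this, Real.exp_add]
      gcongr
      calc _ ≤ Real.exp (Real.log 2) := Real.exp_le_exp.mpr hcy
        _ = 2 := Real.exp_log (by norm_num)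
    generalize Real.exp (-c * (1 - 2 * (k:ℝ) * Real.exp (-c))) = t at h1 ⊢
    have hb := one_add_mul_le_pow (a := -t) (by nlinarith) (k - 1)
    have hcast : ((k - 1 : ℕ) : ℝ) = k - 1 := by
      rw [Nat.cast_sub (by omega)]; simp
    rw [hcast, ← sub_eq_add_neg] at hb
    refine le_trans ?_ hb
    nlinarith
  have hhigh : (1 - Real.exp (-c * 1)) ^ (k - 1) ≤ 1 := by
    apply pow_le_one₀
    · have : Real.exp (-c * 1) ≤ 1 := Real.exp_le_one_iff.mpr (by linarith)
      linarith
    · linarith [Real.exp_pos (-c * 1)]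
  have hle : 1 - 2 * (k:ℝ) * Real.exp (-c) ≤ 1 := by linarith
  exact isPreconnected_Icc.intermediate_value₂ (left_mem_Icc.mpr hle) (right_mem_Icc.mpr hle)
    (f := fun x => x) (g := fun x => (1 - Real.exp (-c * x)) ^ (k - 1))
    (by fun_prop) (by fun_prop) hlow hhigh
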